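/- arXiv:2104.14134 — 2 statements merged into one kernel-verified Lean document; each statement's English description precedes it below -/
import Mathlib

section
/- Consider the linear time-varying system x_{t+1} = A_t x_t + B_t u_t + w_t with A_t ∈ ℝ^{d×d}, B_t ∈ ℝ^{d×p}. Let W, Q ≻ 0 be symmetric d×d matrices, R ≻ 0 a symmetric p×p matrix, and 0 ≤ α < 1/2. Suppose that for every t the COCO-LQ feasible set F(A_t, B_t, W, α) is nonempty and admits a minimizer Σ_t of the cost c(Σ) = Tr(Q Σ_xx) + Tr(R Σ_uu); set K_t = (Σ_{t,xu})ᵀ (Σ_{t,xx})^{-1}. Then for every disturbance sequence (w_t), every initial time t₀ and every t ≥ t₀, the closed-loop trajectory x_{t+1} = (A_t + B_t K_t) x_t + w_t satisfies ‖x_t‖ ≤ κ ρ^{t−t₀} ‖x_{t₀}‖ + (κ/(1−ρ)) · sup_{t₀ ≤ s < t} ‖w_s‖, where ρ = √(α/(1−α)) ∈ [0,1) and κ = κ_W/√(1−α) with κ_W = ‖W‖‖W^{-1}‖. -/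
open Matrix

/-- Spectral norm (operator 2-norm) of a real matrix. -/
noncomputable def specNorm {m n : Type*} [Fintype m] [Fintype n] [DecidableEq n]
    (M : Matrix m n ℝ) : ℝ :=
  ‖LinearMap.toContinuousLinearMap (Matrix.toEuclideanLin M)‖

/-- Apply a matrix to a Euclidean-space vector. -/
noncomputable def applyMat {m n : Type*} [Fintype m] [Fintype n] [DecidableEq n]
    (M : Matrix m n ℝ) (x : EuclideanSpace ℝ n) : EuclideanSpace ℝ m :=
  Matrix.toEuclideanLin M x

/-- The horizontal concatenation `[A B]`. -/
def ABmat {d q : Type*} (A : Matrix d d ℝ) (B : Matrix d q ℝ) : Matrix d (d ⊕ q) ℝ :=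
  Matrix.of fun i => Sum.elim (A i) (B i)

/-- The COCO-LQ feasible set `F(A, B, W, α)`: `Σ ⪰ 0`,
`Σ_xx = [A B] Σ [A B]ᵀ + W`, and `[A B] Σ [A B]ᵀ ⪯ α Σ_xx`. -/
def Feasible {d q : Type*} [Fintype d] [Fintype q] [DecidableEq d] [DecidableEq q]
    (A : Matrix d d ℝ) (B : Matrix d q ℝ) (W : Matrix d d ℝ) (α : ℝ)
    (S : Matrix (d ⊕ q) (d ⊕ q) ℝ) : Prop :=
  S.PosSemidef ∧
  S.toBlocks₁₁ = ABmat A B * S * (ABmat A B)ᵀ + W ∧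
  (α • S.toBlocks₁₁ - ABmat A B * S * (ABmat A B)ᵀ).PosSemidef

/-- The COCO-LQ cost `c(Σ) = Tr(Q Σ_xx) + Tr(R Σ_uu)`. -/
def cost {d q : Type*} [Fintype d] [Fintype q]
    (Q : Matrix d d ℝ) (R : Matrix q q ℝ) (S : Matrix (d ⊕ q) (d ⊕ q) ℝ) : ℝ :=
  (Q * S.toBlocks₁₁).trace + (R * S.toBlocks₂₂).trace

open scoped Matrix.Norms.L2Operator MatrixOrder

theorem specNorm_eq_norm {m n : Type*} [Fintype m] [Fintype n] [DecidableEq n]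
    (M : Matrix m n ℝ) : specNorm M = ‖M‖ := rfl

theorem norm_applyMat_le {m n : Type*} [Fintype m] [Fintype n] [DecidableEq n]
    (M : Matrix m n ℝ) (x : EuclideanSpace ℝ n) : ‖applyMat M x‖ ≤ ‖M‖ * ‖x‖ :=
  Matrix.l2_opNorm_mulVec M x

theorem applyMat_mul {l m n : Type*} [Fintype l] [Fintype m] [Fintype n] [DecidableEq m]
    [DecidableEq n] (M : Matrix l m ℝ) (N : Matrix m n ℝ) (x : EuclideanSpace ℝ n) :
    applyMat (M * N) x = applyMat M (applyMat N x) := by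
  simp [applyMat, Matrix.toLpLin_apply, Matrix.mulVec_mulVec]

theorem applyMat_one {n : Type*} [Fintype n] [DecidableEq n] (x : EuclideanSpace ℝ n) :
    applyMat (1 : Matrix n n ℝ) x = x := by
  simp [applyMat]

/-- If `T Tᵀ ⪯ r² I` with `r ≥ 0`, then `‖T‖ ≤ r`. -/
theorem norm_le_of_posSemidef_sub_mul_transpose {n : Type*} [Fintype n] [DecidableEq n]
    {T : Matrix n n ℝ} {r : ℝ} (hr : 0 ≤ r)
    (h : (r ^ 2 • (1 : Matrix n n ℝ) - T * Tᵀ).PosSemidef) : ‖T‖ ≤ r := by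
  rw [← Matrix.l2_opNorm_conjTranspose T, ← specNorm_eq_norm, specNorm]
  refine ContinuousLinearMap.opNorm_le_bound _ hr fun x => ?_
  refine abs_le_of_sq_le_sq' ?_ (by positivity) |>.2
  have h₁ := h.dotProduct_mulVec_nonneg x.ofLp
  have h₂ : ‖x‖ ^ 2 = x.ofLp ⬝ᵥ x.ofLp := by
    simp only [EuclideanSpace.real_norm_sq_eq, dotProduct, ← sq]
  have h₃ : ‖WithLp.toLp 2 (Tᵀ *ᵥ x.ofLp)‖ ^ 2 = x.ofLp ⬝ᵥ ((T * Tᵀ) *ᵥ x.ofLp) := by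
    rw [← Matrix.mulVec_mulVec, Matrix.dotProduct_mulVec, ← Matrix.mulVec_transpose]
    simp only [EuclideanSpace.real_norm_sq_eq, dotProduct, ← sq]
  have h₄ : ‖WithLp.toLp 2 (Tᵀ *ᵥ x.ofLp)‖ ^ 2 ≤ (r * ‖x‖) ^ 2 := by
    rw [h₃, mul_pow, h₂]
    simpa [Matrix.sub_mulVec, Matrix.smul_mulVec, dotProduct_sub] using h₁
  exact h₄

theorem ABmat_eq_fromCols {d q : Type*} (A : Matrix d d ℝ) (B : Matrix d q ℝ) :
    ABmat A B = Matrix.fromCols A B := by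
  ext i (j | j) <;> rfl

theorem posSemidef_ABmat_mul_mul_transpose {d q : Type*} [Fintype d] [Fintype q]
    (A : Matrix d d ℝ) (B : Matrix d q ℝ) {S : Matrix (d ⊕ q) (d ⊕ q) ℝ} (hS : S.PosSemidef) :
    (ABmat A B * S * (ABmat A B)ᵀ).PosSemidef := by
  simpa using hS.mul_mul_conjTranspose_same (ABmat A B)

/-- The closed loop with gain `K = Σ_xuᵀ Σ_xx⁻¹` propagates no more covariance than `Σ` does. -/
theorem posSemidef_sub_closedLoop {d q : Type*} [Fintype d] [Fintype q]
    [DecidableEq d] [DecidableEq q]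
    (A : Matrix d d ℝ) (B : Matrix d q ℝ) {S : Matrix (d ⊕ q) (d ⊕ q) ℝ}
    (hS : S.PosSemidef) (hP : S.toBlocks₁₁.PosDef) {K : Matrix q d ℝ}
    (hK : K = S.toBlocks₁₂ᵀ * S.toBlocks₁₁⁻¹) :
    (ABmat A B * S * (ABmat A B)ᵀ - (A + B * K) * S.toBlocks₁₁ * (A + B * K)ᵀ).PosSemidef := by
  have hS₂₁ : S.toBlocks₂₁ = S.toBlocks₁₂ᵀ := by
    ext i j
    simpa [toBlocks₂₁, toBlocks₁₂] using (hS.isHermitian.apply (Sum.inr i) (Sum.inl j)).symm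
  have hSb : S = fromBlocks S.toBlocks₁₁ S.toBlocks₁₂ S.toBlocks₁₂ᵀ S.toBlocks₂₂ := by
    rw [← hS₂₁, fromBlocks_toBlocks]
  generalize S.toBlocks₁₁ = P at *
  generalize S.toBlocks₁₂ = U at *
  generalize S.toBlocks₂₂ = V at *
  have hdet : IsUnit P.det := (Matrix.isUnit_iff_isUnit_det _).1 hP.isUnit
  have hPt : Pᵀ = P := by simpa using hP.isHermitian.eq
  have hKP : K * P = Uᵀ := by rw [hK, Matrix.mul_assoc, Matrix.nonsing_inv_mul _ hdet, Matrix.mul_one]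
  have hPK : P * Kᵀ = U := by
    rw [← Matrix.transpose_inj, transpose_mul, transpose_transpose, hPt, hKP]
  have hschur : (V - Uᵀ * P⁻¹ * U).PosSemidef := by
    have : Invertible P := hP.isUnit.invertible
    have h := (hP.fromBlocks₁₁ U V).1 (by simpa [← hSb] using hS)
    simpa using h
  have hKU : Uᵀ * P⁻¹ * U = K * U := by rw [hK]
  have key : ABmat A B * S * (ABmat A B)ᵀ - (A + B * K) * P * (A + B * K)ᵀ
      = B * (V - Uᵀ * P⁻¹ * U) * Bᵀ := by
    have e : (A + B * K) * P = A * P + B * Uᵀ := by rw [add_mul, Matrix.mul_assoc B, hKP]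
    have e' : Uᵀ * Kᵀ = K * U := by rw [← hKP, Matrix.mul_assoc, hPK]
    have e₁ : (A + B * K) * P * (A + B * K)ᵀ
        = A * P * Aᵀ + A * U * Bᵀ + B * Uᵀ * Aᵀ + B * (K * U) * Bᵀ := by
      rw [e, transpose_add, transpose_mul, add_mul, mul_add, mul_add, ← e', ← hPK]
      simp only [transpose_mul, transpose_transpose, Matrix.mul_assoc]
      abel
    rw [e₁, hSb, ABmat_eq_fromCols, transpose_fromCols, fromCols_mul_fromBlocks,
      fromCols_mul_fromRows, hKU]
    simp only [Matrix.add_mul, Matrix.mul_sub, Matrix.sub_mul]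
    abel
  rw [key]
  simpa using hschur.mul_mul_conjTranspose_same B

/-- The disturbance covariance `W` is a common Lyapunov matrix for the closed loops. -/
theorem Feasible.posSemidef_sub_closedLoop {d q : Type*} [Fintype d] [Fintype q]
    [DecidableEq d] [DecidableEq q] {A : Matrix d d ℝ} {B : Matrix d q ℝ} {W : Matrix d d ℝ}
    {α : ℝ} {S : Matrix (d ⊕ q) (d ⊕ q) ℝ} (h : Feasible A B W α S) (hW : W.PosDef)
    (hα0 : 0 ≤ α) (hα1 : α < 1) {K : Matrix q d ℝ}
    (hK : K = S.toBlocks₁₂ᵀ * S.toBlocks₁₁⁻¹) :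
    ((α / (1 - α)) • W - (A + B * K) * W * (A + B * K)ᵀ).PosSemidef := by
  obtain ⟨hS, hxx, hcon⟩ := h
  have hM := posSemidef_ABmat_mul_mul_transpose A B hS
  have hP : S.toBlocks₁₁.PosDef := hxx ▸ Matrix.PosDef.posSemidef_add hM hW
  have hL := _root_.posSemidef_sub_closedLoop A B hS hP hK
  have hα : 0 < 1 - α := by linarith
  generalize ABmat A B * S * (ABmat A B)ᵀ = M at *
  generalize A + B * K = L at *
  rw [hxx] at hcon hL
  have hc := hcon.smul (show 0 ≤ α / (1 - α) by positivity)
  have hLM : (L * M * Lᵀ).PosSemidef := by simpa using hM.mul_mul_conjTranspose_same L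
  convert ((hc.add hcon).add hL).add hLM using 1
  have hs : (α / (1 - α)) • (α • (M + W) - M) + (α • (M + W) - M) = (α / (1 - α)) • W - M := by
    ext i j
    simp only [Matrix.add_apply, Matrix.sub_apply, Matrix.smul_apply, smul_eq_mul]
    field_simp
    ring
  rw [hs, mul_add, add_mul]
  abel

/-- A discrete Grönwall-type bound for `y (t + 1) ≤ ρ y t + c` on a finite horizon. -/
theorem le_pow_mul_add_of_le_mul_add {y : ℕ → ℝ} {ρ c : ℝ} (hρ0 : 0 ≤ ρ) (hρ1 : ρ < 1)
    {a b : ℕ} (hab : a ≤ b) (hc : 0 ≤ c)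
    (h : ∀ s ∈ Finset.Ico a b, y (s + 1) ≤ ρ * y s + c) :
    y b ≤ ρ ^ (b - a) * y a + c / (1 - ρ) := by
  have hρ : 0 < 1 - ρ := by linarith
  induction b, hab using Nat.le_induction with
  | base => simpa using div_nonneg hc hρ.le
  | succ n hn ih =>
    have h₁ := ih fun s hs => h s (by simp only [Finset.mem_Ico] at hs ⊢; omega)
    have h₂ := h n (by simp only [Finset.mem_Ico]; omega)
    rw [Nat.succ_sub hn, pow_succ]
    have h₃ := mul_le_mul_of_nonneg_left h₁ hρ0
    have h₄ : ρ * (c / (1 - ρ)) + c = c / (1 - ρ) := by field_simp; ring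
    linarith

theorem le_biSup_of_mem_finset {ι : Type*} {f : ι → ℝ} (hf : ∀ i, 0 ≤ f i) {s : Finset ι} {i : ι}
    (hi : i ∈ s) : f i ≤ ⨆ j ∈ s, f j := by
  have hb : BddAbove (Set.range fun j => ⨆ _ : j ∈ s, f j) := by
    refine ⟨∑ k ∈ s, f k, ?_⟩
    rintro _ ⟨j, rfl⟩
    exact Real.iSup_le (fun hj => Finset.single_le_sum (fun k _ => hf k) hj)
      (Finset.sum_nonneg fun k _ => hf k)
  simpa [hi] using le_ciSup hb i

/-- Theorem 1 of the paper: if for every `t` the COCO-LQ SDP has a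
minimizer `Σ_t` over the feasible set `F(A_t, B_t, W, α)` with `0 ≤ α < 1/2`, and
`K_t = Σ_{t,xu}ᵀ Σ_{t,xx}⁻¹`, then the closed-loop trajectory
`x_{t+1} = (A_t + B_t K_t) x_t + w_t` satisfies
`‖x_t‖ ≤ κ ρ^{t−t₀} ‖x_{t₀}‖ + (κ/(1−ρ)) · sup_{t₀ ≤ s < t} ‖w_s‖`
with `ρ = √(α/(1−α))` and `κ = ‖W‖‖W⁻¹‖/√(1−α)`. -/
theorem stmt0 {d p : ℕ}
    (A : ℕ → Matrix (Fin d) (Fin d) ℝ) (B : ℕ → Matrix (Fin d) (Fin p) ℝ)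
    (W Q : Matrix (Fin d) (Fin d) ℝ) (R : Matrix (Fin p) (Fin p) ℝ)
    (hW : W.PosDef) (hQ : Q.PosDef) (hR : R.PosDef)
    (α : ℝ) (hα0 : 0 ≤ α) (hα : α < 1 / 2)
    (S : ℕ → Matrix (Fin d ⊕ Fin p) (Fin d ⊕ Fin p) ℝ)
    (hfeas : ∀ t, Feasible (A t) (B t) W α (S t))
    (hmin : ∀ t, ∀ S', Feasible (A t) (B t) W α S' → cost Q R (S t) ≤ cost Q R S')
    (K : ℕ → Matrix (Fin p) (Fin d) ℝ)
    (hK : ∀ t, K t = ((S t).toBlocks₁₂)ᵀ * ((S t).toBlocks₁₁)⁻¹)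
    (ρ κ : ℝ) (hρ : ρ = Real.sqrt (α / (1 - α)))
    (hκ : κ = specNorm W * specNorm W⁻¹ / Real.sqrt (1 - α))
    (t₀ : ℕ) (x w : ℕ → EuclideanSpace ℝ (Fin d))
    (hdyn : ∀ t, t₀ ≤ t → x (t + 1) = applyMat (A t + B t * K t) (x t) + w t) :
    ∀ t, t₀ ≤ t →
      ‖x t‖ ≤ κ * ρ ^ (t - t₀) * ‖x t₀‖
        + κ / (1 - ρ) * ⨆ s ∈ Finset.Ico t₀ t, ‖w s‖ := by
  obtain ⟨C, hC⟩ : ∃ C : Matrix (Fin d) (Fin d) ℝ, W = C * Cᵀ :=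
    CStarAlgebra.nonneg_iff_eq_mul_star_self.1 hW.posSemidef.nonneg
  have hdet : IsUnit C.det := by
    have h := (Matrix.isUnit_iff_isUnit_det _).1 hW.isUnit
    rw [hC, det_mul] at h
    exact isUnit_of_mul_isUnit_left h
  have hCt : IsUnit Cᵀ.det := by rwa [det_transpose]
  have hnW : ‖W‖ = ‖C‖ * ‖C‖ := by
    have h := Matrix.l2_opNorm_conjTranspose_mul_self Cᴴ
    rw [conjTranspose_conjTranspose, Matrix.l2_opNorm_conjTranspose] at h
    rw [hC, ← h, conjTranspose_eq_transpose_of_trivial]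
  have hnWi : ‖W⁻¹‖ = ‖C⁻¹‖ * ‖C⁻¹‖ := by
    rw [← Matrix.l2_opNorm_conjTranspose_mul_self C⁻¹, hC, Matrix.mul_inv_rev,
      conjTranspose_eq_transpose_of_trivial, transpose_nonsing_inv]
  have hα1 : 0 < 1 - α := by linarith
  have hr0 : 0 ≤ α / (1 - α) := by positivity
  have hρ0 : 0 ≤ ρ := hρ ▸ Real.sqrt_nonneg _
  have hρsq : ρ ^ 2 = α / (1 - α) := by rw [hρ, Real.sq_sqrt hr0]
  have hρ1 : ρ < 1 := by
    rw [hρ, Real.sqrt_lt' one_pos, div_lt_iff₀ hα1]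
    linarith
  have hT : ∀ t, ‖C⁻¹ * (A t + B t * K t) * C‖ ≤ ρ := fun t => by
    refine norm_le_of_posSemidef_sub_mul_transpose hρ0 ?_
    have h := ((hfeas t).posSemidef_sub_closedLoop hW hα0 (by linarith) (hK t)
      ).mul_mul_conjTranspose_same C⁻¹
    convert h using 1
    rw [hρsq, conjTranspose_eq_transpose_of_trivial, mul_sub, sub_mul, hC, mul_smul_comm,
      smul_mul_assoc, transpose_nonsing_inv]
    congr 1
    · rw [Matrix.mul_assoc, Matrix.mul_assoc, Matrix.mul_nonsing_inv _ hCt, mul_one,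
        Matrix.nonsing_inv_mul _ hdet]
    · simp only [transpose_mul, Matrix.mul_assoc, transpose_nonsing_inv]
  have hk : ‖C‖ * ‖C⁻¹‖ ≤ κ := by
    have h₁ : ‖C‖ ≤ ‖C‖ * ‖C⁻¹‖ * ‖C‖ := by
      calc ‖C‖ = ‖C * C⁻¹ * C‖ := by rw [Matrix.mul_nonsing_inv _ hdet, one_mul]
        _ ≤ ‖C * C⁻¹‖ * ‖C‖ := norm_mul_le _ _
        _ ≤ ‖C‖ * ‖C⁻¹‖ * ‖C‖ := by gcongr; exact norm_mul_le _ _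
    have h₂ := mul_le_mul_of_nonneg_right h₁ (norm_nonneg C⁻¹)
    rw [hκ, specNorm_eq_norm, specNorm_eq_norm, hnW, hnWi, le_div_iff₀ (Real.sqrt_pos.2 hα1)]
    have h₃ : √(1 - α) ≤ 1 := Real.sqrt_le_one.2 (by linarith)
    calc ‖C‖ * ‖C⁻¹‖ * √(1 - α) ≤ ‖C‖ * ‖C⁻¹‖ := mul_le_of_le_one_right (by positivity) h₃
      _ ≤ _ := by linarith
  intro t ht
  set m := ⨆ s ∈ Finset.Ico t₀ t, ‖w s‖ with hm
  have hm0 : 0 ≤ m := Real.iSup_nonneg fun _ => Real.iSup_nonneg fun _ => norm_nonneg _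
  have hstep : ∀ s ∈ Finset.Ico t₀ t, ‖applyMat C⁻¹ (x (s + 1))‖
      ≤ ρ * ‖applyMat C⁻¹ (x s)‖ + ‖C⁻¹‖ * m := fun s hs => by
    have e : applyMat C⁻¹ (x (s + 1)) = applyMat (C⁻¹ * (A s + B s * K s) * C)
        (applyMat C⁻¹ (x s)) + applyMat C⁻¹ (w s) := by
      rw [← applyMat_mul, Matrix.mul_assoc _ C, Matrix.mul_nonsing_inv _ hdet, mul_one,
        applyMat_mul, hdyn s (Finset.mem_Ico.1 hs).1]
      exact map_add _ _ _
    rw [e]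
    refine (norm_add_le _ _).trans (add_le_add ?_ ?_)
    · exact (norm_applyMat_le _ _).trans (by gcongr; exact hT s)
    · refine (norm_applyMat_le _ _).trans ?_
      gcongr
      exact le_biSup_of_mem_finset (f := fun s => ‖w s‖) (fun _ => norm_nonneg _) hs
  have hy := le_pow_mul_add_of_le_mul_add (y := fun s => ‖applyMat C⁻¹ (x s)‖) hρ0 hρ1 ht
    (by positivity) hstep
  have hρ' : 0 < 1 - ρ := by linarith
  calc ‖x t‖ = ‖applyMat C (applyMat C⁻¹ (x t))‖ := by
        rw [← applyMat_mul, Matrix.mul_nonsing_inv _ hdet, applyMat_one]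
    _ ≤ ‖C‖ * ‖applyMat C⁻¹ (x t)‖ := norm_applyMat_le _ _
    _ ≤ ‖C‖ * (ρ ^ (t - t₀) * (‖C⁻¹‖ * ‖x t₀‖) + ‖C⁻¹‖ * m / (1 - ρ)) := by
        gcongr
        exact hy.trans (by gcongr; exact norm_applyMat_le _ _)
    _ = ‖C‖ * ‖C⁻¹‖ * ρ ^ (t - t₀) * ‖x t₀‖ + ‖C‖ * ‖C⁻¹‖ / (1 - ρ) * m := by ring
    _ ≤ κ * ρ ^ (t - t₀) * ‖x t₀‖ + κ / (1 - ρ) * m := by gcongr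
end

section
/- Let (H_t) be a sequence of invertible d×d matrices and (L_t) a sequence of d×d matrices, and let β₁, β₂ > 0, κ = β₁/β₂, γ ∈ (0,1], ρ > 0 be such that for all t: ‖L_t‖ ≤ 1 − γ, ‖H_t‖ ≤ β₁, ‖H_t^{−1}‖ ≤ 1/β₂, and ‖H_{t+1}^{−1} H_t‖ ≤ ρ/(1−γ). Then for all integers s < t, the ordered product satisfies ‖(H_{t−1} L_{t−1} H_{t−1}^{−1})(H_{t−2} L_{t−2} H_{t−2}^{−1}) ⋯ (H_s L_s H_s^{−1})‖ ≤ κ (1−γ) ρ^{t−s−1}. -/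
open Matrix

/-- `backProd M s n = M (s+n−1) * ⋯ * M (s+1) * M s` (ordered product; `1` if `n = 0`). -/
def backProd {d : Type*} [Fintype d] [DecidableEq d]
    (M : ℕ → Matrix d d ℝ) (s : ℕ) : ℕ → Matrix d d ℝ
  | 0 => 1
  | n + 1 => M (s + n) * backProd M s n

theorem specNorm_nonneg {m n : Type*} [Fintype m] [Fintype n] [DecidableEq n]
    (M : Matrix m n ℝ) : 0 ≤ specNorm M :=
  norm_nonneg _

theorem specNorm_mul_le {l m n : Type*} [Fintype l] [Fintype m] [Fintype n]
    [DecidableEq m] [DecidableEq n] (A : Matrix l m ℝ) (B : Matrix m n ℝ) :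
    specNorm (A * B) ≤ specNorm A * specNorm B := by
  have h : LinearMap.toContinuousLinearMap (Matrix.toEuclideanLin (A * B)) =
      (LinearMap.toContinuousLinearMap (Matrix.toEuclideanLin A)).comp
        (LinearMap.toContinuousLinearMap (Matrix.toEuclideanLin B)) := by
    ext x i
    simp [Matrix.toLpLin_apply, Matrix.mulVec_mulVec]
  unfold specNorm
  rw [h]
  exact ContinuousLinearMap.opNorm_comp_le _ _

theorem specNorm_mul_le_of_le {l m n : Type*} [Fintype l] [Fintype m] [Fintype n]
    [DecidableEq m] [DecidableEq n] {A : Matrix l m ℝ} {B : Matrix m n ℝ} {a b : ℝ}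
    (hA : specNorm A ≤ a) (hB : specNorm B ≤ b) : specNorm (A * B) ≤ a * b :=
  (specNorm_mul_le A B).trans
    (mul_le_mul hA hB (specNorm_nonneg B) ((specNorm_nonneg A).trans hA))

/-- A product of conjugates telescopes, up to the outermost conjugating factors, into a matrix
whose norm decays geometrically. -/
theorem exists_backProd_conj_eq {d : Type*} [Fintype d] [DecidableEq d]
    (H L : ℕ → Matrix d d ℝ) {c ρ : ℝ} (hL : ∀ t, specNorm (L t) ≤ c)
    (hHH : ∀ t, specNorm ((H (t + 1))⁻¹ * H t) ≤ ρ / c) (s n : ℕ) :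
    ∃ P : Matrix d d ℝ, backProd (fun r => H r * L r * (H r)⁻¹) s (n + 1) =
      H (s + n) * P * (H s)⁻¹ ∧ specNorm P ≤ c * ρ ^ n := by
  induction n with
  | zero => exact ⟨L s, by simp [backProd], by simpa using hL s⟩
  | succ n ih =>
    obtain ⟨P, hP, hPn⟩ := ih
    refine ⟨L (s + n + 1) * ((H (s + n + 1))⁻¹ * H (s + n)) * P, ?_, ?_⟩
    · rw [backProd, hP]
      simp only [← add_assoc, Matrix.mul_assoc]
    · refine (specNorm_mul_le_of_le (specNorm_mul_le_of_le (hL _) (hHH _)) hPn).trans_eq ?_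
      by_cases hc : c = 0
      · simp [hc]
      · field_simp
        ring

/-- given invertible `H_t` and matrices `L_t` with `‖L_t‖ ≤ 1 − γ`,
`‖H_t‖ ≤ β₁`, `‖H_t⁻¹‖ ≤ 1/β₂`, `‖H_{t+1}⁻¹ H_t‖ ≤ ρ/(1−γ)`, the ordered product
`(H_{t−1} L_{t−1} H_{t−1}⁻¹) ⋯ (H_s L_s H_s⁻¹)` has spectral norm at most
`κ (1−γ) ρ^{t−s−1}`, where `κ = β₁/β₂`. -/
theorem stmt4 {d : ℕ}
    (H L : ℕ → Matrix (Fin d) (Fin d) ℝ)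
    (hinv : ∀ t, IsUnit (H t))
    (β₁ β₂ κ γ ρ : ℝ) (hβ₁ : 0 < β₁) (hβ₂ : 0 < β₂) (hκ : κ = β₁ / β₂)
    (hγ0 : 0 < γ) (hγ1 : γ ≤ 1) (hρ : 0 < ρ)
    (hL : ∀ t, specNorm (L t) ≤ 1 - γ)
    (hH : ∀ t, specNorm (H t) ≤ β₁)
    (hHinv : ∀ t, specNorm (H t)⁻¹ ≤ 1 / β₂)
    (hHH : ∀ t, specNorm ((H (t + 1))⁻¹ * H t) ≤ ρ / (1 - γ)) :
    ∀ s t : ℕ, s < t →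
      specNorm (backProd (fun r => H r * L r * (H r)⁻¹) s (t - s))
        ≤ κ * (1 - γ) * ρ ^ (t - s - 1) := by
  intro s t hst
  obtain ⟨n, rfl⟩ := Nat.exists_eq_add_of_lt hst
  have hn : s + n + 1 - s = n + 1 := by omega
  rw [hn, Nat.add_sub_cancel]
  obtain ⟨P, hP, hPn⟩ := exists_backProd_conj_eq H L hL hHH s n
  rw [hP, hκ]
  refine (specNorm_mul_le_of_le (specNorm_mul_le_of_le (hH _) hPn) (hHinv s)).trans_eq ?_
  ring
end
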